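/- Fix p ∈ (0,1] and for each n ≥ 3 fix three distinct vertices s, a, b of ⃗G(n,p). Then Cov({s↛a}, {b↛s}) = (2p − 1 + o(1))·(1 − p/2)^{2n−3} as n → ∞; that is, Cov({s↛a}, {b↛s})/(1 − p/2)^{2n−3} → 2p − 1. -/

import Mathlib

open Filter Real

/-- Edges of the complete graph on `Fin n`: ordered pairs `(u,v)` with `u < v`. -/
abbrev Edge (n : ℕ) : Type := {e : Fin n × Fin n // e.1 < e.2}

/-- A configuration of the random edge-orientation model: for each pair `u < v`,
`none` means no edge, `some true` means the directed edge `u → v`, and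
`some false` means the directed edge `v → u`. -/
abbrev Config (n : ℕ) : Type := Edge n → Option Bool

/-- The directed edge relation determined by a configuration. -/
def DirEdge {n : ℕ} (f : Config n) (u v : Fin n) : Prop :=
  (∃ h : u < v, f ⟨(u, v), h⟩ = some true) ∨ (∃ h : v < u, f ⟨(v, u), h⟩ = some false)

/-- `Reaches f u v`: the configuration `f` contains a directed path from `u` to `v`
(paths of length `0` are allowed, so `Reaches f u u` always holds). -/
def Reaches {n : ℕ} (f : Config n) (u v : Fin n) : Prop :=
  Relation.ReflTransGen (DirEdge f) u v

/-- The probability of an event under a weight function on a finite sample space. -/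
noncomputable def prWeight {α : Type*} [Fintype α] (w : α → ℝ) (E : Set α) : ℝ :=
  ∑ x, E.indicator w x

/-- The weight of one edge state in `⃗G(n,p)`: no edge has probability `1 - p`
and each of the two orientations has probability `p/2`. -/
noncomputable def edgeWeight (p : ℝ) : Option Bool → ℝ
  | none => 1 - p
  | some _ => p / 2

/-- The probability of an event in the random directed graph `⃗G(n,p)`. -/
noncomputable def PrGnp (n : ℕ) (p : ℝ) (E : Set (Config n)) : ℝ :=
  prWeight (fun f => ∏ e : Edge n, edgeWeight p (f e)) E

/-- The number of present edges of a configuration. -/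
def edgeCount {n : ℕ} (f : Config n) : ℕ :=
  (Finset.univ.filter fun e : Edge n => (f e).isSome).card

/-- The probability of an event in the random directed graph `⃗G(n,m)`:
the underlying graph is uniform among the graphs with exactly `m` edges, and each
present edge is oriented in one of its two directions with probability `1/2`,
independently over edges. -/
noncomputable def PrGnm (n m : ℕ) (E : Set (Config n)) : ℝ :=
  prWeight (fun f => if edgeCount f = m
      then ((Nat.choose (Nat.choose n 2) m : ℝ) * 2 ^ m)⁻¹ else 0) E

/-- The event that no edge of `F` is present. -/
def forbidEvent {N : ℕ} (F : Finset (Fin N × Fin N)) : Set (Config N) :=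
  {f | ∀ x ∈ F, ¬ DirEdge f x.1 x.2}

/-- The number of vertices whose colour is not `M`. -/
def offCount {N : ℕ} {κ : Type*} [DecidableEq κ] (c : Fin N → κ) (M : κ) : ℕ :=
  (Finset.univ.filter fun v => c v ≠ M).card

section Probability

variable {N : ℕ} {p : ℝ}

lemma configWeight_nonneg (hp : p ∈ Set.Ioc (0 : ℝ) 1) (f : Config N) :
    0 ≤ ∏ e : Edge N, edgeWeight p (f e) := by
  refine Finset.prod_nonneg fun e _ => ?_
  obtain ⟨h0, h1⟩ := hp
  cases f e <;> simp only [edgeWeight] <;> linarith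

lemma PrGnp_nonneg (hp : p ∈ Set.Ioc (0 : ℝ) 1) (E : Set (Config N)) : 0 ≤ PrGnp N p E :=
  Finset.sum_nonneg fun f _ => Set.indicator_nonneg (fun f _ => configWeight_nonneg hp f) f

lemma PrGnp_mono (hp : p ∈ Set.Ioc (0 : ℝ) 1) {E E' : Set (Config N)} (h : E ⊆ E') :
    PrGnp N p E ≤ PrGnp N p E' :=
  Finset.sum_le_sum fun f _ =>
    Set.indicator_le_indicator_of_subset h (fun f => configWeight_nonneg hp f) f

lemma PrGnp_union_add_inter (E E' : Set (Config N)) :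
    PrGnp N p (E ∪ E') + PrGnp N p (E ∩ E') = PrGnp N p E + PrGnp N p E' := by
  simp only [PrGnp, prWeight, ← Finset.sum_add_distrib]
  refine Finset.sum_congr rfl fun f _ => ?_
  exact Set.indicator_union_add_inter_apply _ _ _ _

lemma PrGnp_union_le (hp : p ∈ Set.Ioc (0 : ℝ) 1) (E E' : Set (Config N)) :
    PrGnp N p (E ∪ E') ≤ PrGnp N p E + PrGnp N p E' := by
  linarith [PrGnp_union_add_inter (p := p) E E', PrGnp_nonneg hp (E ∩ E')]

lemma PrGnp_biUnion_le (hp : p ∈ Set.Ioc (0 : ℝ) 1) {ι : Type*} (R : Finset ι)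
    (E : ι → Set (Config N)) :
    PrGnp N p (⋃ i ∈ R, E i) ≤ ∑ i ∈ R, PrGnp N p (E i) := by
  classical
  induction R using Finset.induction_on with
  | empty => simp [PrGnp, prWeight]
  | insert i R hi ih =>
    rw [Finset.set_biUnion_insert, Finset.sum_insert hi]
    linarith [PrGnp_union_le hp (E i) (⋃ i ∈ R, E i)]

lemma prod_edge_mul_swap (g : Fin N × Fin N → ℝ) :
    ∏ e : Edge N, (g e.1 * g e.1.swap) = ∏ x ∈ Finset.univ.offDiag, g x := by
  have h1 : ∏ e : Edge N, (g e.1 * g e.1.swap) =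
      ∏ x ∈ Finset.univ.filter (fun x : Fin N × Fin N => x.1 < x.2), (g x * g x.swap) :=
    (Finset.prod_subtype _ (by simp) (fun x => g x * g x.swap)).symm
  have h2 : ∏ x ∈ Finset.univ.filter (fun x : Fin N × Fin N => x.1 < x.2), g x.swap =
      ∏ x ∈ Finset.univ.filter (fun x : Fin N × Fin N => x.2 < x.1), g x :=
    Finset.prod_nbij' Prod.swap Prod.swap (by simp) (by simp) (by simp) (by simp) (by simp)
  rw [h1, Finset.prod_mul_distrib, h2, ← Finset.prod_union]
  · refine Finset.prod_congr ?_ fun _ _ => rfl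
    ext x
    simp [lt_or_lt_iff_ne]
  · rw [Finset.disjoint_filter]
    intro x _ h h'
    exact lt_asymm h h'

lemma mem_forbidEvent_iff (F : Finset (Fin N × Fin N)) (f : Config N) :
    f ∈ forbidEvent F ↔
      ∀ e : Edge N, (e.1 ∈ F → f e ≠ some true) ∧ (e.1.swap ∈ F → f e ≠ some false) := by
  constructor
  · intro h e
    refine ⟨fun he hf => h _ he (Or.inl ⟨e.2, hf⟩), fun he hf => h _ he (Or.inr ⟨e.2, hf⟩)⟩
  · rintro h ⟨u, v⟩ hx (⟨huv, hf⟩ | ⟨hvu, hf⟩)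
    · exact (h ⟨(u, v), huv⟩).1 hx hf
    · exact (h ⟨(v, u), hvu⟩).2 hx hf

lemma PrGnp_forbidEvent (hp : p ∈ Set.Ioc (0 : ℝ) 1) (F : Finset (Fin N × Fin N))
    (hF : ∀ x ∈ F, x.1 ≠ x.2) :
    PrGnp N p (forbidEvent F) =
      ∏ x ∈ F, if x.swap ∈ F then √(1 - p) else 1 - p / 2 := by
  classical
  let g : Fin N × Fin N → ℝ := fun x =>
    if x ∈ F then (if x.swap ∈ F then √(1 - p) else 1 - p / 2) else 1
  have h1 : PrGnp N p (forbidEvent F) = ∑ f : Config N, ∏ e : Edge N,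
      (if (e.1 ∈ F → f e ≠ some true) ∧ (e.1.swap ∈ F → f e ≠ some false)
        then edgeWeight p (f e) else 0) := by
    refine Finset.sum_congr rfl fun f _ => ?_
    rw [Set.indicator_apply]
    split_ifs with h
    · rw [mem_forbidEvent_iff F] at h
      exact Finset.prod_congr rfl fun e _ => (if_pos (h e)).symm
    · rw [mem_forbidEvent_iff F] at h
      push Not at h
      obtain ⟨e, he⟩ := h
      refine (Finset.prod_eq_zero (Finset.mem_univ e) (if_neg ?_)).symm
      rintro ⟨h1, h2⟩
      obtain ⟨h3, h4⟩ := he h1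
      exact h2 h3 h4
  have h2 : ∀ e : Edge N, ∑ o : Option Bool,
      (if (e.1 ∈ F → o ≠ some true) ∧ (e.1.swap ∈ F → o ≠ some false)
        then edgeWeight p o else 0) = g e.1 * g e.1.swap := by
    intro e
    have hs : √(1 - p) * √(1 - p) = 1 - p := Real.mul_self_sqrt (by linarith [hp.2])
    by_cases ha : e.1 ∈ F <;> by_cases hb : e.1.swap ∈ F <;>
      simp [g, ha, hb, Fintype.sum_option, edgeWeight, hs] <;> ring
  rw [h1, ← Finset.sum_congr Fintype.piFinset_univ (fun _ _ => rfl),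
    ← Finset.prod_univ_sum (fun _ => Finset.univ)
      (fun (e : Edge N) o => if (e.1 ∈ F → o ≠ some true) ∧ (e.1.swap ∈ F → o ≠ some false)
        then edgeWeight p o else 0), Finset.prod_congr rfl (fun e _ => h2 e),
    prod_edge_mul_swap]
  have h3 : F ⊆ Finset.univ.offDiag := fun x hx => by simpa using hF x hx
  rw [← Finset.prod_subset h3 (fun x _ hx => by simp [g, hx])]
  exact Finset.prod_congr rfl fun x hx => by simp [g, hx]

lemma sqrt_one_sub_le (hp : p ∈ Set.Ioc (0 : ℝ) 1) : √(1 - p) ≤ 1 - p / 2 := by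
  rw [Real.sqrt_le_left (by linarith [hp.2])]
  nlinarith [sq_nonneg p]

lemma PrGnp_forbidEvent_eq_pow (hp : p ∈ Set.Ioc (0 : ℝ) 1) (F : Finset (Fin N × Fin N))
    (hF : ∀ x ∈ F, x.swap ∉ F) :
    PrGnp N p (forbidEvent F) = (1 - p / 2) ^ F.card := by
  rw [PrGnp_forbidEvent hp F]
  · rw [Finset.prod_congr rfl (fun x hx => if_neg (hF x hx)), Finset.prod_const]
  · rintro ⟨u, v⟩ hx (rfl : u = v)
    exact hF _ hx hx

lemma PrGnp_forbidEvent_le_pow (hp : p ∈ Set.Ioc (0 : ℝ) 1) (F : Finset (Fin N × Fin N))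
    (hF : ∀ x ∈ F, x.1 ≠ x.2) :
    PrGnp N p (forbidEvent F) ≤ (1 - p / 2) ^ F.card := by
  rw [PrGnp_forbidEvent hp F hF, ← Finset.prod_const]
  refine Finset.prod_le_prod (fun x _ => ?_) (fun x _ => ?_)
  · split_ifs
    · positivity
    · linarith [hp.2]
  · split_ifs
    · exact sqrt_one_sub_le hp
    · exact le_rfl

lemma PrGnp_forbidEvent_le_sqrt_pow (hp : p ∈ Set.Ioc (0 : ℝ) 1)
    (F G : Finset (Fin N × Fin N)) (hF : ∀ x ∈ F, x.1 ≠ x.2) (hG : G ⊆ F)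
    (hG' : ∀ x ∈ G, x.swap ∈ F) :
    PrGnp N p (forbidEvent F) ≤ √(1 - p) ^ G.card := by
  have hq : 0 ≤ 1 - p / 2 := by linarith [hp.2]
  rw [PrGnp_forbidEvent hp F hF, ← Finset.prod_sdiff hG, ← Finset.prod_const,
    Finset.prod_congr (s₁ := G) rfl (fun x hx => if_pos (hG' x hx))]
  refine mul_le_of_le_one_left (Finset.prod_nonneg fun _ _ => Real.sqrt_nonneg _)
    (Finset.prod_le_one (fun x _ => ?_) (fun x _ => ?_))
  · split_ifs
    · positivity
    · exact hq
  · split_ifs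
    · linarith [sqrt_one_sub_le hp, hp.1]
    · linarith [hp.1]

lemma forbidEvent_inter (F G : Finset (Fin N × Fin N)) :
    forbidEvent F ∩ forbidEvent G = forbidEvent (F ∪ G) := by
  ext f
  simp only [forbidEvent, Set.mem_inter_iff, Set.mem_ofPred_eq, Finset.mem_union]
  exact ⟨fun h x hx => hx.elim (h.1 x) (h.2 x),
    fun h => ⟨fun x hx => h x (Or.inl hx), fun x hx => h x (Or.inr hx)⟩⟩

end Probability

section Colorings

variable {N : ℕ} {κ : Type*} [DecidableEq κ]

lemma offCount_add_card (c : Fin N → κ) (M : κ) :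
    offCount c M + (Finset.univ.filter fun v => c v = M).card = N := by
  rw [add_comm]
  simpa [offCount] using Finset.card_filter_add_card_filter_not (s := Finset.univ)
    (fun v : Fin N => c v = M)

lemma card_crossing_bounds (c : Fin N → κ) (F : Finset (Fin N × Fin N))
    (hF : ∀ u v, c u ≠ c v → (u, v) ∈ F ∨ (v, u) ∈ F) (M : κ)
    (hM : ∀ k, offCount c M ≤ offCount c k) :
    N * offCount c M ≤ 2 * F.card ∧ offCount c M * (N - offCount c M) ≤ F.card := by
  set X : Finset (Fin N × Fin N) := Finset.univ.filter fun x => c x.1 ≠ c x.2 with hX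
  have hXF : X.card ≤ 2 * F.card := by
    have hsub : X ⊆ F ∪ F.map (Equiv.prodComm _ _).toEmbedding := by
      rintro ⟨u, v⟩ hx
      simp only [hX, Finset.mem_filter, Finset.mem_univ, true_and] at hx
      rcases hF u v hx with h | h <;> simp [h]
    have := (Finset.card_le_card hsub).trans (Finset.card_union_le _ _)
    rw [Finset.card_map] at this
    omega
  constructor
  · refine le_trans ?_ hXF
    have h1 : X.card = ∑ u : Fin N, offCount c (c u) := by
      rw [hX, ← Finset.univ_product_univ, Finset.card_filter, Finset.sum_product]
      refine Finset.sum_congr rfl fun u _ => ?_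
      rw [offCount, Finset.card_filter]
      exact Finset.sum_congr rfl fun v _ => by simp only [ne_comm]
    rw [h1]
    calc N * offCount c M = ∑ _u : Fin N, offCount c M := by simp
      _ ≤ _ := Finset.sum_le_sum fun u _ => hM (c u)
  · set A := Finset.univ.filter fun v => c v ≠ M with hA
    set B := Finset.univ.filter fun v => c v = M with hB
    have hAB : A ×ˢ B ∪ B ×ˢ A ⊆ X := by
      rintro ⟨u, v⟩ hx
      simp only [hA, hB, hX, Finset.mem_union, Finset.mem_product, Finset.mem_filter,
        Finset.mem_univ, true_and] at hx ⊢
      rcases hx with ⟨h, h'⟩ | ⟨h, h'⟩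
      · rw [h']; exact h
      · rw [h]; exact h'.symm
    have hd : Disjoint (A ×ˢ B) (B ×ˢ A) := by
      rw [Finset.disjoint_left]
      rintro ⟨u, v⟩ hx hy
      simp only [hA, hB, Finset.mem_product, Finset.mem_filter,
        Finset.mem_univ, true_and] at hx hy
      exact hx.1 hy.1
    have h1 := Finset.card_le_card hAB
    rw [Finset.card_union_of_disjoint hd, Finset.card_product, Finset.card_product,
      mul_comm B.card] at h1
    have h2 : N - offCount c M = B.card := by
      have h : offCount c M + B.card = N := offCount_add_card c M
      omega
    have h3 : offCount c M = A.card := rfl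
    rw [h2, h3]
    omega

lemma sum_colorings_le [Fintype κ] (R : Finset (Fin N → κ)) (w : (Fin N → κ) → ℝ) {Q y : ℝ}
    (hQ : 0 ≤ Q) (hy : 0 ≤ y) (h : ∀ c ∈ R, ∃ M, w c ≤ Q * y ^ offCount c M) :
    ∑ c ∈ R, w c ≤ Fintype.card κ * (Q * (1 + Fintype.card κ * y) ^ N) := by
  have key : ∀ M : κ, ∑ c : Fin N → κ, y ^ offCount c M ≤ (1 + Fintype.card κ * y) ^ N := by
    intro M
    have h1 : ∀ c : Fin N → κ, y ^ offCount c M = ∏ v, if c v ≠ M then y else 1 := by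
      intro c
      rw [Finset.prod_ite]
      simp [offCount]
    have h2 : ∑ k : κ, (if k ≠ M then y else 1) ≤ 1 + Fintype.card κ * y := by
      calc ∑ k : κ, (if k ≠ M then y else 1)
          ≤ ∑ k : κ, ((if k = M then 1 else 0) + y) := by
            refine Finset.sum_le_sum fun k _ => ?_
            by_cases hk : k = M <;> simp [hk, hy]
        _ = _ := by simp [Finset.sum_add_distrib]
    rw [Finset.sum_congr rfl (fun c _ => h1 c),
      ← Finset.sum_congr Fintype.piFinset_univ (fun _ _ => rfl),
      ← Finset.prod_univ_sum (fun _ => Finset.univ)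
        (fun (_ : Fin N) k => if k ≠ M then y else 1), Finset.prod_const, Finset.card_univ,
      Fintype.card_fin]
    exact pow_le_pow_left₀ (Finset.sum_nonneg fun k _ => by split_ifs <;> simp [hy]) h2 N
  calc ∑ c ∈ R, w c ≤ ∑ c ∈ R, ∑ M, Q * y ^ offCount c M := by
        refine Finset.sum_le_sum fun c hc => ?_
        obtain ⟨M, hM⟩ := h c hc
        exact hM.trans (Finset.single_le_sum (f := fun M => Q * y ^ offCount c M)
          (fun _ _ => by positivity) (Finset.mem_univ M))
    _ ≤ ∑ c, ∑ M, Q * y ^ offCount c M :=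
        Finset.sum_le_univ_sum_of_nonneg fun c => Finset.sum_nonneg fun _ _ => by positivity
    _ = ∑ M, Q * ∑ c, y ^ offCount c M := by
        rw [Finset.sum_comm]
        exact Finset.sum_congr rfl fun M _ => (Finset.mul_sum _ _ _).symm
    _ ≤ ∑ _M : κ, Q * (1 + Fintype.card κ * y) ^ N :=
        Finset.sum_le_sum fun M _ => mul_le_mul_of_nonneg_left (key M) hQ
    _ = _ := by simp

lemma exists_majority [Fintype κ] [Nonempty κ] (c : Fin N → κ) :
    ∃ M, ∀ k, offCount c M ≤ offCount c k :=
  Finite.exists_min (offCount c)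

lemma pow_le_of_exponent {q θ : ℝ} (hq : 0 ≤ q) (hθ0 : 0 ≤ θ) (hθ1 : θ ≤ 1)
    (hqθ : q ≤ θ ^ 20) {e m t : ℕ} (h : 20 * m + N + N * t ≤ 20 * e) :
    q ^ e ≤ q ^ m * θ ^ N * (θ ^ N) ^ t := by
  obtain ⟨d, rfl⟩ : ∃ d, e = m + d := ⟨e - m, by omega⟩
  rw [pow_add, mul_assoc]
  refine mul_le_mul_of_nonneg_left ?_ (by positivity)
  calc q ^ d ≤ (θ ^ 20) ^ d := pow_le_pow_left₀ hq hqθ d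
    _ = θ ^ (20 * d) := (pow_mul _ _ _).symm
    _ ≤ θ ^ (N + N * t) := pow_le_pow_of_le_one hθ0 hθ1 (by omega)
    _ = _ := by rw [pow_add, pow_mul]

end Colorings

lemma exists_decay_rate {p : ℝ} (hp : p ∈ Set.Ioc (0 : ℝ) 1) :
    ∃ θ : ℝ, 0 < θ ∧ θ < 1 ∧ 1 - p / 2 ≤ θ ^ 20 ∧ 1 - p ≤ (1 - p / 2) ^ 2 * θ ^ 3 := by
  have h1 : ∀ᶠ θ : ℝ in nhds 1, 1 - p / 2 < θ ^ 20 :=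
    (by fun_prop : Continuous fun θ : ℝ => θ ^ 20).continuousAt.eventually
      (lt_mem_nhds (by simp only [one_pow]; linarith [hp.1]))
  have h2 : ∀ᶠ θ : ℝ in nhds 1, 1 - p < (1 - p / 2) ^ 2 * θ ^ 3 :=
    (by fun_prop : Continuous fun θ : ℝ => (1 - p / 2) ^ 2 * θ ^ 3).continuousAt.eventually
      (lt_mem_nhds (by simp only [one_pow]; nlinarith [hp.1, mul_pos hp.1 hp.1]))
  have h3 : ∀ᶠ θ : ℝ in nhds 1, 0 < θ := lt_mem_nhds one_pos
  have h4 : ∀ᶠ θ : ℝ in nhdsWithin 1 (Set.Iio 1), θ < 1 := self_mem_nhdsWithin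
  obtain ⟨θ, hθ⟩ := (((h1.and (h2.and h3)).filter_mono nhdsWithin_le_nhds).and h4).exists
  exact ⟨θ, hθ.1.2.2, hθ.2, hθ.1.1.le, hθ.1.2.1.le⟩

lemma tendsto_decay {θ : ℝ} (h0 : 0 < θ) (h1 : θ < 1) (k : ℝ) (hk : 0 ≤ k) :
    Tendsto (fun n : ℕ => θ ^ n * (1 + k * θ ^ n) ^ n) atTop (nhds 0) := by
  have hA : Tendsto (fun n : ℕ => θ ^ n) atTop (nhds 0) :=
    tendsto_pow_atTop_nhds_zero_of_lt_one h0.le h1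
  have hB : Tendsto (fun n : ℕ => (n : ℝ) * θ ^ n) atTop (nhds 0) :=
    tendsto_self_mul_const_pow_of_lt_one h0.le h1
  have hC : Tendsto (fun n : ℕ => θ ^ n * Real.exp (k * ((n : ℝ) * θ ^ n))) atTop (nhds 0) := by
    have := hA.mul ((Real.continuous_exp.tendsto _).comp (hB.const_mul k))
    simpa using this
  refine squeeze_zero (fun n => by positivity) (fun n => ?_) hC
  refine mul_le_mul_of_nonneg_left ?_ (by positivity)
  calc (1 + k * θ ^ n) ^ n ≤ Real.exp (k * θ ^ n) ^ n :=
        pow_le_pow_left₀ (by positivity) (by linarith [Real.add_one_le_exp (k * θ ^ n)]) n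
    _ = _ := by rw [← Real.exp_nat_mul]; ring_nf

section Reachability

variable {N : ℕ} {f : Config N}

lemma not_reaches_of_closed (P : Fin N → Prop) {u v : Fin N} (hu : P u) (hv : ¬ P v)
    (h : ∀ x y, P x → ¬ P y → ¬ DirEdge f x y) : ¬ Reaches f u v := by
  intro huv
  refine hv ?_
  clear hv
  induction huv with
  | refl => exact hu
  | tail _ hxy ih => exact by_contra fun hy => h _ _ ih hy hxy

lemma not_dirEdge_of_reaches_from {s u v : Fin N} (hu : Reaches f s u) (hv : ¬ Reaches f s v) :
    ¬ DirEdge f u v :=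
  fun h => hv (Relation.ReflTransGen.tail hu h)

lemma not_dirEdge_of_reaches_to {s u v : Fin N} (hu : ¬ Reaches f u s) (hv : Reaches f v s) :
    ¬ DirEdge f u v :=
  fun h => hu (Relation.ReflTransGen.head h hv)

end Reachability

section Cuts

variable {N : ℕ} {p : ℝ}

/-- Pairs directed from the colour `true` to the colour `false`. -/
def cutPairs (c : Fin N → Bool) : Finset (Fin N × Fin N) :=
  Finset.univ.filter fun x => c x.1 = true ∧ c x.2 = false

/-- Pairs leaving the set with first colour `true` or entering the set with second colour
`true`. -/
def doubleCutPairs (c : Fin N → Bool × Bool) : Finset (Fin N × Fin N) :=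
  Finset.univ.filter fun x =>
    ((c x.1).1 = true ∧ (c x.2).1 = false) ∨ ((c x.1).2 = false ∧ (c x.2).2 = true)

lemma eq_or_eq_of_offCount_le_two {κ : Type*} [DecidableEq κ] {c : Fin N → κ} {M : κ}
    (h : offCount c M ≤ 2) {u v : Fin N} (huv : u ≠ v) (hu : c u ≠ M) (hv : c v ≠ M)
    {x : Fin N} (hx : c x ≠ M) : x = u ∨ x = v := by
  have h1 : ({u, v} : Finset (Fin N)) ⊆ Finset.univ.filter fun v => c v ≠ M := by
    intro y hy
    simp only [Finset.mem_insert, Finset.mem_singleton] at hy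
    rcases hy with rfl | rfl <;> simpa
  have h2 := Finset.eq_of_subset_of_card_le h1 (by rw [Finset.card_pair huv]; exact h)
  have h3 : x ∈ Finset.univ.filter fun v => c v ≠ M := by simpa
  rw [← h2] at h3
  simpa using h3

lemma eq_of_offCount_le_one {κ : Type*} [DecidableEq κ] {c : Fin N → κ} {M : κ}
    (h : offCount c M ≤ 1) {u x : Fin N} (hu : c u ≠ M) (hx : c x ≠ M) : x = u :=
  Finset.card_le_one.mp h x (by simpa) u (by simpa)

lemma PrGnp_cut_le (hp : p ∈ Set.Ioc (0 : ℝ) 1) {θ : ℝ} (hθ0 : 0 < θ) (hθ1 : θ < 1)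
    (hqθ : 1 - p / 2 ≤ θ ^ 20) (hN : 12 ≤ N) (c : Fin N → Bool)
    (hc : ∀ M, 2 ≤ offCount c M) :
    ∃ M, PrGnp N p (forbidEvent (cutPairs c)) ≤
      ((1 - p / 2) ^ N * θ ^ N) * (θ ^ N) ^ offCount c M := by
  obtain ⟨M, hM⟩ := exists_majority c
  refine ⟨M, (PrGnp_forbidEvent_le_pow hp _ ?_).trans
    (pow_le_of_exponent (by linarith [hp.2]) hθ0.le hθ1.le hqθ ?_)⟩
  · rintro ⟨u, v⟩ h (rfl : u = v)
    simp only [cutPairs, Finset.mem_filter] at h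
    simp [h.2.1] at h
  · obtain ⟨h1, h2⟩ := card_crossing_bounds c (cutPairs c) (fun u v huv => by
      simp only [cutPairs, Finset.mem_filter, Finset.mem_univ, true_and]
      revert huv
      cases c u <;> cases c v <;> simp) M hM
    have h3 := hc M
    generalize offCount c M = t at *
    rcases h3.eq_or_lt with rfl | h4
    · omega
    · nlinarith

lemma PrGnp_doubleCut_le (hp : p ∈ Set.Ioc (0 : ℝ) 1) {θ : ℝ} (hθ0 : 0 < θ) (hθ1 : θ < 1)
    (hqθ : 1 - p / 2 ≤ θ ^ 20) (hrθ : 1 - p ≤ (1 - p / 2) ^ 2 * θ ^ 3) (hN : 12 ≤ N)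
    (c : Fin N → Bool × Bool)
    (hc : (∃ M, offCount c M ≤ 2 ∧ N - 2 ≤
        (Finset.univ.filter fun v => c v = (true, true)).card *
          (Finset.univ.filter fun v => c v = (false, false)).card) ∨
      ∀ M, 3 ≤ offCount c M) :
    ∃ M, PrGnp N p (forbidEvent (doubleCutPairs c)) ≤
      (((1 - p / 2) ^ 4 * θ ^ 6)⁻¹ * ((1 - p / 2) ^ (2 * N) * θ ^ N)) *
        (θ ^ N) ^ offCount c M := by
  have hq0 : 0 < 1 - p / 2 := by linarith [hp.2]
  have hq1 : 1 - p / 2 ≤ 1 := by linarith [hp.1]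
  have hr0 : 0 ≤ 1 - p := by linarith [hp.2]
  have hF : ∀ x ∈ doubleCutPairs c, x.1 ≠ x.2 := by
    rintro ⟨u, v⟩ h (rfl : u = v)
    simp only [doubleCutPairs, Finset.mem_filter] at h
    rcases h.2 with h | h <;> simp [h.1] at h
  rcases hc with ⟨M, hM, hIL⟩ | hc
  · refine ⟨M, ?_⟩
    set A := Finset.univ.filter fun v => c v = (true, true) with hA
    set B := Finset.univ.filter fun v => c v = (false, false) with hB
    have hd : Disjoint (A ×ˢ B) (B ×ˢ A) := by
      rw [Finset.disjoint_left]
      rintro ⟨u, v⟩ hx hy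
      simp only [hA, hB, Finset.mem_product, Finset.mem_filter,
        Finset.mem_univ, true_and] at hx hy
      simp [hx.1] at hy
    have h1 := PrGnp_forbidEvent_le_sqrt_pow hp (doubleCutPairs c) (A ×ˢ B ∪ B ×ˢ A) hF
      (by
        rintro ⟨u, v⟩ hx
        simp only [hA, hB, Finset.mem_union, Finset.mem_product, Finset.mem_filter,
          Finset.mem_univ, true_and] at hx
        simp only [doubleCutPairs, Finset.mem_filter, Finset.mem_univ, true_and]
        rcases hx with ⟨h, h'⟩ | ⟨h, h'⟩ <;> simp [h, h'])
      (by
        rintro ⟨u, v⟩ hx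
        simp only [hA, hB, Finset.mem_union, Finset.mem_product, Finset.mem_filter,
          Finset.mem_univ, true_and] at hx
        simp only [doubleCutPairs, Finset.mem_filter, Finset.mem_univ, true_and]
        rcases hx with ⟨h, h'⟩ | ⟨h, h'⟩ <;> simp [h, h'])
    rw [Finset.card_union_of_disjoint hd, Finset.card_product, Finset.card_product,
      mul_comm B.card, ← two_mul, pow_mul, Real.sq_sqrt hr0] at h1
    have h2 : (1 - p) ^ (A.card * B.card) ≤ ((1 - p / 2) ^ 2 * θ ^ 3) ^ (N - 2) :=
      (pow_le_pow_of_le_one hr0 (by linarith [hp.1]) hIL).trans (pow_le_pow_left₀ hr0 hrθ _)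
    have h3 : ((1 - p / 2) ^ 2 * θ ^ 3) ^ (N - 2) =
        ((1 - p / 2) ^ 4 * θ ^ 6)⁻¹ * ((1 - p / 2) ^ (2 * N) * θ ^ N) * (θ ^ N) ^ 2 := by
      obtain ⟨k, rfl⟩ : ∃ k, N = k + 2 := ⟨N - 2, by omega⟩
      rw [Nat.add_sub_cancel]
      generalize 1 - p / 2 = q at hq0 ⊢
      field_simp
      ring
    refine h1.trans (h2.trans (h3.le.trans ?_))
    refine mul_le_mul_of_nonneg_left ?_ (by positivity)
    exact pow_le_pow_of_le_one (by positivity) (pow_le_one₀ hθ0.le hθ1.le) hM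
  · obtain ⟨M, hM⟩ := exists_majority c
    have h0 : (1 - p / 2) ^ (doubleCutPairs c).card ≤
        (1 - p / 2) ^ (2 * N) * θ ^ N * (θ ^ N) ^ offCount c M := by
      refine pow_le_of_exponent hq0.le hθ0.le hθ1.le hqθ ?_
      obtain ⟨h1, h2⟩ := card_crossing_bounds c (doubleCutPairs c) (fun u v huv => by
        simp only [doubleCutPairs, Finset.mem_filter, Finset.mem_univ, true_and]
        revert huv
        rcases c u with ⟨_ | _, _ | _⟩ <;> rcases c v with ⟨_ | _, _ | _⟩ <;> simp) M hM
      have h3 := hc M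
      generalize offCount c M = t at *
      rcases h3.eq_or_lt with rfl | h4
      · omega
      · rcases (Nat.succ_le_of_lt h4).eq_or_lt with rfl | h5
        · omega
        · nlinarith
    refine ⟨M, (PrGnp_forbidEvent_le_pow hp _ hF).trans (h0.trans ?_)⟩
    rw [mul_assoc (((1 - p / 2) ^ 4 * θ ^ 6)⁻¹)]
    refine le_mul_of_one_le_left (by positivity) ((one_le_inv₀ (by positivity)).2 ?_)
    exact mul_le_one₀ (pow_le_one₀ hq0.le hq1) (by positivity) (pow_le_one₀ hθ0.le hθ1.le)

end Cuts

section SingleEvent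

variable {N : ℕ} {p : ℝ}

lemma not_reaches_subset (s a : Fin N) :
    {f : Config N | ¬ Reaches f s a} ⊆
      (forbidEvent ({s} ×ˢ {s}ᶜ) ∪ forbidEvent ({a}ᶜ ×ˢ {a})) ∪
        ⋃ c ∈ Finset.univ.filter (fun c : Fin N → Bool => ∀ M, 2 ≤ offCount c M),
          forbidEvent (cutPairs c) := by
  classical
  intro f hf
  have hf : ¬ Reaches f s a := hf
  set c : Fin N → Bool := fun v => decide (Reaches f s v) with hc
  have hs : Reaches f s s := Relation.ReflTransGen.refl
  by_cases h : ∀ M, 2 ≤ offCount c M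
  · refine Or.inr (Set.mem_biUnion
      (Finset.mem_coe.2 (Finset.mem_filter.2 ⟨Finset.mem_univ c, h⟩)) ?_)
    rintro ⟨u, v⟩ hx
    simp only [cutPairs, hc, Finset.mem_filter, decide_eq_true_eq, decide_eq_false_iff_not] at hx
    exact not_dirEdge_of_reaches_from hx.2.1 hx.2.2
  · push Not at h
    obtain ⟨M, hM⟩ := h
    have hM : offCount c M ≤ 1 := by omega
    left
    cases M
    · left
      rintro ⟨u, v⟩ hx
      simp only [Finset.mem_product, Finset.mem_singleton, Finset.mem_compl] at hx
      obtain ⟨rfl, hv⟩ := hx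
      refine not_dirEdge_of_reaches_from hs fun h => hv ?_
      exact eq_of_offCount_le_one hM (by simpa [hc] using hs) (by simpa [hc] using h)
    · right
      rintro ⟨u, v⟩ hx
      simp only [Finset.mem_product, Finset.mem_singleton, Finset.mem_compl] at hx
      obtain ⟨hu, rfl⟩ := hx
      refine not_dirEdge_of_reaches_from (by_contra fun h => hu ?_) hf
      exact eq_of_offCount_le_one hM (by simpa [hc] using hf) (by simpa [hc] using h)

lemma subset_not_reaches {s a : Fin N} (hsa : s ≠ a) :
    forbidEvent ({s} ×ˢ {s}ᶜ) ∪ forbidEvent ({a}ᶜ ×ˢ {a}) ⊆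
      {f : Config N | ¬ Reaches f s a} := by
  rintro f (hf | hf)
  · refine not_reaches_of_closed (fun x => x = s) rfl hsa.symm fun x y hx hy => hf (x, y) ?_
    simp [hx, hy]
  · refine not_reaches_of_closed (fun x => x ≠ a) hsa (by simp) fun x y hx hy => hf (x, y) ?_
    simp [hx, not_not.1 hy]

lemma PrGnp_out (hp : p ∈ Set.Ioc (0 : ℝ) 1) (s : Fin N) :
    PrGnp N p (forbidEvent ({s} ×ˢ {s}ᶜ)) = (1 - p / 2) ^ (N - 1) := by
  rw [PrGnp_forbidEvent_eq_pow hp]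
  · simp [Finset.card_compl]
  · rintro ⟨u, v⟩ h
    simp only [Finset.mem_product, Finset.mem_singleton, Finset.mem_compl, Prod.swap] at h ⊢
    tauto

lemma PrGnp_in (hp : p ∈ Set.Ioc (0 : ℝ) 1) (a : Fin N) :
    PrGnp N p (forbidEvent ({a}ᶜ ×ˢ {a})) = (1 - p / 2) ^ (N - 1) := by
  rw [PrGnp_forbidEvent_eq_pow hp]
  · simp [Finset.card_compl]
  · rintro ⟨u, v⟩ h
    simp only [Finset.mem_product, Finset.mem_singleton, Finset.mem_compl, Prod.swap] at h ⊢
    tauto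

lemma PrGnp_not_reaches_le (hp : p ∈ Set.Ioc (0 : ℝ) 1) {θ : ℝ} (hθ0 : 0 < θ) (hθ1 : θ < 1)
    (hqθ : 1 - p / 2 ≤ θ ^ 20) (hN : 12 ≤ N) (s a : Fin N) :
    PrGnp N p {f | ¬ Reaches f s a} ≤ 2 * (1 - p / 2) ^ (N - 1) +
      2 * (((1 - p / 2) ^ N * θ ^ N) * (1 + 2 * θ ^ N) ^ N) := by
  have hq0 : 0 < 1 - p / 2 := by linarith [hp.2]
  refine (PrGnp_mono hp (not_reaches_subset s a)).trans ((PrGnp_union_le hp _ _).trans ?_)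
  refine add_le_add ((PrGnp_union_le hp _ _).trans ?_) ((PrGnp_biUnion_le hp _ _).trans ?_)
  · rw [PrGnp_out hp, PrGnp_in hp, two_mul]
  · have := sum_colorings_le
      (Finset.univ.filter (fun c : Fin N → Bool => ∀ M, 2 ≤ offCount c M))
      (fun c => PrGnp N p (forbidEvent (cutPairs c)))
      (Q := (1 - p / 2) ^ N * θ ^ N) (y := θ ^ N) (by positivity) (by positivity)
      (fun c hc => PrGnp_cut_le hp hθ0 hθ1 hqθ hN c (Finset.mem_filter.1 hc).2)
    simpa using this

lemma le_PrGnp_not_reaches (hp : p ∈ Set.Ioc (0 : ℝ) 1) {s a : Fin N} (hsa : s ≠ a) :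
    2 * (1 - p / 2) ^ (N - 1) - (1 - p / 2) ^ (2 * N - 3) ≤
      PrGnp N p {f | ¬ Reaches f s a} := by
  have hq0 : 0 ≤ 1 - p / 2 := by linarith [hp.2]
  have hq1 : 1 - p / 2 ≤ 1 := by linarith [hp.1]
  have h1 := PrGnp_mono hp (subset_not_reaches hsa)
  have h2 := PrGnp_union_add_inter (p := p) (forbidEvent ({s} ×ˢ {s}ᶜ))
    (forbidEvent ({a}ᶜ ×ˢ {a}))
  rw [PrGnp_out hp, PrGnp_in hp, forbidEvent_inter] at h2
  have h3 := PrGnp_forbidEvent_le_pow hp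
    ({s} ×ˢ {s}ᶜ ∪ {a}ᶜ ×ˢ {a} : Finset (Fin N × Fin N)) (by
    rintro ⟨u, v⟩ hx (rfl : u = v)
    simp only [Finset.mem_union, Finset.mem_product, Finset.mem_singleton,
      Finset.mem_compl] at hx
    tauto)
  have hcard : 2 * N - 3 ≤ (({s} ×ˢ {s}ᶜ) ∪ ({a}ᶜ ×ˢ {a}) : Finset (Fin N × Fin N)).card := by
    have hsub : (({s} ×ˢ {s}ᶜ) ∪ ({s, a}ᶜ ×ˢ {a}) : Finset (Fin N × Fin N)) ⊆
        (({s} ×ˢ {s}ᶜ) ∪ ({a}ᶜ ×ˢ {a}) : Finset (Fin N × Fin N)) := by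
      rintro ⟨u, v⟩ hx
      simp only [Finset.mem_union, Finset.mem_product, Finset.mem_singleton,
        Finset.mem_compl, Finset.mem_insert] at hx ⊢
      tauto
    refine le_trans (le_of_eq ?_) (Finset.card_le_card hsub)
    rw [Finset.card_union_of_disjoint]
    · simp only [Finset.card_product, Finset.card_compl, Finset.card_singleton,
        Finset.card_pair hsa, Fintype.card_fin]
      have := s.pos
      omega
    · rw [Finset.disjoint_left]
      rintro ⟨u, v⟩ hx hy
      simp only [Finset.mem_product, Finset.mem_singleton,
        Finset.mem_compl, Finset.mem_insert] at hx hy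
      tauto
  have h4 := pow_le_pow_of_le_one hq0 hq1 hcard
  linarith

end SingleEvent

section JointEvent

variable {N : ℕ} {p : ℝ}

/-- Pairs entering `a` or leaving `b`. -/
def sinkSourcePairs (a b : Fin N) : Finset (Fin N × Fin N) :=
  ({b} ×ˢ {b}ᶜ) ∪ ({a, b}ᶜ ×ˢ {a})

/-- Pairs leaving `b`, or leaving `s` other than `(s, b)`. -/
def outPairs (s b : Fin N) : Finset (Fin N × Fin N) :=
  ({b} ×ˢ {b}ᶜ) ∪ ({s} ×ˢ {s, b}ᶜ)

/-- Pairs entering `a`, or entering `s` other than `(a, s)`. -/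
def inPairs (s a : Fin N) : Finset (Fin N × Fin N) :=
  ({a}ᶜ ×ˢ {a}) ∪ ({a, s}ᶜ ×ˢ {s})

/-- Colourings of the vertices that give a negligible contribution to the joint event. -/
def negligibleColorings (N : ℕ) : Finset (Fin N → Bool × Bool) :=
  Finset.univ.filter fun c =>
    (∃ M, offCount c M ≤ 2 ∧ N - 2 ≤
        (Finset.univ.filter fun v => c v = (true, true)).card *
          (Finset.univ.filter fun v => c v = (false, false)).card) ∨
      ∀ M, 3 ≤ offCount c M

lemma mem_sinkSourcePairs {a b u v : Fin N} :
    (u, v) ∈ sinkSourcePairs a b ↔ (u = b ∧ v ≠ b) ∨ ((u ≠ a ∧ u ≠ b) ∧ v = a) := by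
  simp only [sinkSourcePairs, Finset.mem_union, Finset.mem_product, Finset.mem_singleton,
    Finset.mem_compl, Finset.mem_insert, not_or, ne_eq]

lemma mem_outPairs {s b u v : Fin N} :
    (u, v) ∈ outPairs s b ↔ (u = b ∧ v ≠ b) ∨ (u = s ∧ v ≠ s ∧ v ≠ b) := by
  simp only [outPairs, Finset.mem_union, Finset.mem_product, Finset.mem_singleton,
    Finset.mem_compl, Finset.mem_insert, not_or, ne_eq]

lemma mem_inPairs {s a u v : Fin N} :
    (u, v) ∈ inPairs s a ↔ (u ≠ a ∧ v = a) ∨ ((u ≠ a ∧ u ≠ s) ∧ v = s) := by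
  simp only [inPairs, Finset.mem_union, Finset.mem_product, Finset.mem_singleton,
    Finset.mem_compl, Finset.mem_insert, not_or, ne_eq]

lemma joint_subset {s a b : Fin N} (hsa : s ≠ a) (hsb : s ≠ b) (hab : a ≠ b) :
    {f : Config N | ¬ Reaches f s a ∧ ¬ Reaches f b s} ⊆
      ((forbidEvent (sinkSourcePairs a b) ∪ forbidEvent (outPairs s b)) ∪
        forbidEvent (inPairs s a)) ∪
        ⋃ c ∈ negligibleColorings N, forbidEvent (doubleCutPairs c) := by
  classical
  rintro f ⟨ha, hb⟩
  set c : Fin N → Bool × Bool := fun v => (decide (Reaches f s v), decide (Reaches f v s))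
    with hc
  have hs : Reaches f s s := Relation.ReflTransGen.refl
  by_cases hneg : c ∈ negligibleColorings N
  · refine Or.inr (Set.mem_biUnion (Finset.mem_coe.2 hneg) ?_)
    rintro ⟨u, v⟩ hx
    simp only [doubleCutPairs, hc, Finset.mem_filter, decide_eq_true_eq,
      decide_eq_false_iff_not] at hx
    rcases hx.2 with h | h
    · exact not_dirEdge_of_reaches_from h.1 h.2
    · exact not_dirEdge_of_reaches_to h.1 h.2
  left
  simp only [negligibleColorings, Finset.mem_filter, Finset.mem_univ, true_and] at hneg
  push Not at hneg
  obtain ⟨hneg, M, hM⟩ := hneg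
  have hM : offCount c M ≤ 2 := by omega
  have hsmall := hneg M hM
  have hcard := offCount_add_card c M
  have hcs : c s = (true, true) := by simp [hc, hs]
  obtain ⟨_ | _, _ | _⟩ := M
  · exfalso
    have h1 : 1 ≤ (Finset.univ.filter fun v => c v = (true, true)).card :=
      Finset.card_pos.2 ⟨s, by simp [hcs]⟩
    have h2 := Nat.le_mul_of_pos_left
      (Finset.univ.filter fun v => c v = (false, false)).card h1
    omega
  · left; right
    have hx : ∀ x, x ≠ s → x ≠ b → ¬ Reaches f s x ∧ Reaches f x s := by
      intro x h1 h2
      have h3 : c x = (false, true) := by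
        by_contra h
        rcases eq_or_eq_of_offCount_le_two hM hsb (by simp [hcs]) (by simp [hc, hb]) h with h | h
        · exact h1 h
        · exact h2 h
      simpa [hc] using h3
    rintro ⟨u, v⟩ huv
    rw [mem_outPairs] at huv
    rcases huv with ⟨rfl, hv⟩ | ⟨rfl, hv, hv'⟩
    · refine not_dirEdge_of_reaches_to hb ?_
      rcases eq_or_ne v s with rfl | hvs
      · exact hs
      · exact (hx v hvs hv).2
    · exact not_dirEdge_of_reaches_from hs (hx v hv hv').1
  · right
    have hx : ∀ x, x ≠ s → x ≠ a → Reaches f s x ∧ ¬ Reaches f x s := by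
      intro x h1 h2
      have h3 : c x = (true, false) := by
        by_contra h
        rcases eq_or_eq_of_offCount_le_two hM hsa (by simp [hcs]) (by simp [hc, ha]) h with h | h
        · exact h1 h
        · exact h2 h
      simpa [hc] using h3
    rintro ⟨u, v⟩ huv
    rw [mem_inPairs] at huv
    rcases huv with ⟨hu, rfl⟩ | ⟨⟨hu, hu'⟩, rfl⟩
    · refine not_dirEdge_of_reaches_from ?_ ha
      rcases eq_or_ne u s with rfl | hus
      · exact hs
      · exact (hx u hus hu).1
    · exact not_dirEdge_of_reaches_to (hx u hu' hu).2 hs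
  · left; left
    have hx : ∀ x, x ≠ a → x ≠ b → Reaches f s x ∧ Reaches f x s := by
      intro x h1 h2
      have h3 : c x = (true, true) := by
        by_contra h
        rcases eq_or_eq_of_offCount_le_two hM hab (by simp [hc, ha]) (by simp [hc, hb]) h
          with h | h
        · exact h1 h
        · exact h2 h
      simpa [hc] using h3
    have hor : Reaches f a s ∨ Reaches f s b := by
      by_contra! h
      have h1 : 1 ≤ (Finset.univ.filter fun v => c v = (false, false)).card :=
        Finset.card_pos.2 ⟨a, by simp [hc, ha, h.1]⟩
      have h2 := Nat.le_mul_of_pos_right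
        (Finset.univ.filter fun v => c v = (true, true)).card h1
      omega
    rintro ⟨u, v⟩ huv
    rw [mem_sinkSourcePairs] at huv
    rcases huv with ⟨rfl, hv⟩ | ⟨⟨hu, hu'⟩, rfl⟩
    · rcases eq_or_ne v a with rfl | hva
      · rcases hor with h | h
        · exact not_dirEdge_of_reaches_to hb h
        · exact not_dirEdge_of_reaches_from h ha
      · exact not_dirEdge_of_reaches_to hb (hx v hva hv).2
    · exact not_dirEdge_of_reaches_from (hx u hu hu').1 ha

lemma subset_joint {s a b : Fin N} (hsa : s ≠ a) (hsb : s ≠ b) (hab : a ≠ b) :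
    (forbidEvent (sinkSourcePairs a b) ∪ forbidEvent (outPairs s b)) ∪
        forbidEvent (inPairs s a) ⊆
      {f : Config N | ¬ Reaches f s a ∧ ¬ Reaches f b s} := by
  rintro f ((hf | hf) | hf)
  · constructor
    · refine not_reaches_of_closed (fun x => x ≠ a) hsa (by simp) fun x y hx hy => hf (x, y) ?_
      rw [mem_sinkSourcePairs]
      grind
    · refine not_reaches_of_closed (fun x => x = b) rfl hsb fun x y hx hy => hf (x, y) ?_
      rw [mem_sinkSourcePairs]
      grind
  · constructor
    · refine not_reaches_of_closed (fun x => x = s ∨ x = b) (Or.inl rfl) (by grind)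
        fun x y hx hy => hf (x, y) ?_
      rw [mem_outPairs]
      grind
    · refine not_reaches_of_closed (fun x => x = b) rfl hsb fun x y hx hy => hf (x, y) ?_
      rw [mem_outPairs]
      grind
  · constructor
    · refine not_reaches_of_closed (fun x => x ≠ a) hsa (by simp) fun x y hx hy => hf (x, y) ?_
      rw [mem_inPairs]
      grind
    · refine not_reaches_of_closed (fun x => x ≠ a ∧ x ≠ s) (by grind) (by grind)
        fun x y hx hy => ?_
      rcases eq_or_ne y a with rfl | hya
      · refine hf (x, y) ?_
        rw [mem_inPairs]
        grind
      · refine hf (x, y) ?_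
        rw [mem_inPairs]
        grind

lemma PrGnp_sinkSource (hp : p ∈ Set.Ioc (0 : ℝ) 1) {a b : Fin N} (hab : a ≠ b) :
    PrGnp N p (forbidEvent (sinkSourcePairs a b)) = (1 - p / 2) ^ (2 * N - 3) := by
  rw [PrGnp_forbidEvent_eq_pow hp]
  · rw [sinkSourcePairs, Finset.card_union_of_disjoint]
    · simp only [Finset.card_product, Finset.card_compl, Finset.card_singleton,
        Finset.card_pair hab, Fintype.card_fin]
      congr 1
      have := a.pos
      omega
    · rw [Finset.disjoint_left]
      rintro ⟨u, v⟩ hx hy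
      simp only [Finset.mem_product, Finset.mem_singleton,
        Finset.mem_compl, Finset.mem_insert] at hx hy
      tauto
  · rintro ⟨u, v⟩ h
    rw [Prod.swap_prod_mk, mem_sinkSourcePairs] at *
    grind

lemma PrGnp_outPairs (hp : p ∈ Set.Ioc (0 : ℝ) 1) {s b : Fin N} (hsb : s ≠ b) :
    PrGnp N p (forbidEvent (outPairs s b)) = (1 - p / 2) ^ (2 * N - 3) := by
  rw [PrGnp_forbidEvent_eq_pow hp]
  · rw [outPairs, Finset.card_union_of_disjoint]
    · simp only [Finset.card_product, Finset.card_compl, Finset.card_singleton,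
        Finset.card_pair hsb, Fintype.card_fin]
      congr 1
      have := s.pos
      omega
    · rw [Finset.disjoint_left]
      rintro ⟨u, v⟩ hx hy
      simp only [Finset.mem_product, Finset.mem_singleton] at hx hy
      exact hsb (hy.1.symm.trans hx.1)
  · rintro ⟨u, v⟩ h
    rw [Prod.swap_prod_mk, mem_outPairs] at *
    grind

lemma PrGnp_inPairs (hp : p ∈ Set.Ioc (0 : ℝ) 1) {s a : Fin N} (hsa : s ≠ a) :
    PrGnp N p (forbidEvent (inPairs s a)) = (1 - p / 2) ^ (2 * N - 3) := by
  rw [PrGnp_forbidEvent_eq_pow hp]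
  · rw [inPairs, Finset.card_union_of_disjoint]
    · simp only [Finset.card_product, Finset.card_compl, Finset.card_singleton,
        Finset.card_pair hsa.symm, Fintype.card_fin]
      congr 1
      have := s.pos
      omega
    · rw [Finset.disjoint_left]
      rintro ⟨u, v⟩ hx hy
      simp only [Finset.mem_product, Finset.mem_singleton] at hx hy
      exact hsa (hy.2.symm.trans hx.2)
  · rintro ⟨u, v⟩ h
    rw [Prod.swap_prod_mk, mem_inPairs] at *
    grind

lemma PrGnp_joint_le (hp : p ∈ Set.Ioc (0 : ℝ) 1) {θ : ℝ} (hθ0 : 0 < θ) (hθ1 : θ < 1)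
    (hqθ : 1 - p / 2 ≤ θ ^ 20) (hrθ : 1 - p ≤ (1 - p / 2) ^ 2 * θ ^ 3) (hN : 12 ≤ N)
    {s a b : Fin N} (hsa : s ≠ a) (hsb : s ≠ b) (hab : a ≠ b) :
    PrGnp N p {f | ¬ Reaches f s a ∧ ¬ Reaches f b s} ≤ 3 * (1 - p / 2) ^ (2 * N - 3) +
      4 * (((1 - p / 2) ^ 4 * θ ^ 6)⁻¹ * ((1 - p / 2) ^ (2 * N) * θ ^ N) *
        (1 + 4 * θ ^ N) ^ N) := by
  have hq0 : 0 < 1 - p / 2 := by linarith [hp.2]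
  refine (PrGnp_mono hp (joint_subset hsa hsb hab)).trans ((PrGnp_union_le hp _ _).trans ?_)
  refine add_le_add ((PrGnp_union_le hp _ _).trans ?_) ((PrGnp_biUnion_le hp _ _).trans ?_)
  · have h1 := PrGnp_union_le hp (forbidEvent (sinkSourcePairs a b)) (forbidEvent (outPairs s b))
    rw [PrGnp_sinkSource hp hab, PrGnp_outPairs hp hsb] at h1
    rw [PrGnp_inPairs hp hsa]
    linarith
  · have := sum_colorings_le (negligibleColorings N)
      (fun c => PrGnp N p (forbidEvent (doubleCutPairs c)))
      (Q := ((1 - p / 2) ^ 4 * θ ^ 6)⁻¹ * ((1 - p / 2) ^ (2 * N) * θ ^ N)) (y := θ ^ N)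
      (by positivity) (by positivity)
      (fun c hc => PrGnp_doubleCut_le hp hθ0 hθ1 hqθ hrθ hN c (Finset.mem_filter.1 hc).2)
    simpa using this

lemma le_PrGnp_joint (hp : p ∈ Set.Ioc (0 : ℝ) 1)
    {s a b : Fin N} (hsa : s ≠ a) (hsb : s ≠ b) (hab : a ≠ b) :
    3 * (1 - p / 2) ^ (2 * N - 3) - 3 * (1 - p / 2) ^ (3 * N - 6) ≤
      PrGnp N p {f | ¬ Reaches f s a ∧ ¬ Reaches f b s} := by
  have hq0 : 0 ≤ 1 - p / 2 := by linarith [hp.2]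
  have hq1 : 1 - p / 2 ≤ 1 := by linarith [hp.1]
  have hc3 : ({s, a, b} : Finset (Fin N)).card = 3 := Finset.card_eq_three.2
    ⟨s, a, b, hsa, hsb, hab, rfl⟩
  have hN3 : 3 ≤ N := by
    have := Finset.card_le_univ ({s, a, b} : Finset (Fin N))
    rwa [hc3, Fintype.card_fin] at this
  have key : ∀ F X Y Z : Finset (Fin N × Fin N), X ⊆ F → Y ⊆ F → Z ⊆ F →
      Disjoint X Y → Disjoint X Z → Disjoint Y Z → X.card + Y.card + Z.card = 3 * N - 6 →
      (∀ x ∈ F, x.1 ≠ x.2) →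
      PrGnp N p (forbidEvent F) ≤ (1 - p / 2) ^ (3 * N - 6) := by
    intro F X Y Z hX hY hZ hXY hXZ hYZ hcard hF
    refine (PrGnp_forbidEvent_le_pow hp F hF).trans (pow_le_pow_of_le_one hq0 hq1 ?_)
    rw [← hcard, ← Finset.card_union_of_disjoint hXY,
      ← Finset.card_union_of_disjoint (Finset.disjoint_union_left.2 ⟨hXZ, hYZ⟩)]
    exact Finset.card_le_card (Finset.union_subset (Finset.union_subset hX hY) hZ)
  have h12 : PrGnp N p (forbidEvent (sinkSourcePairs a b ∪ outPairs s b)) ≤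
      (1 - p / 2) ^ (3 * N - 6) := by
    apply key _ ({b} ×ˢ {b}ᶜ) ({a, b}ᶜ ×ˢ {a}) ({s} ×ˢ {s, a, b}ᶜ)
    all_goals first
      | (rintro ⟨u, v⟩ hx
         simp only [Finset.mem_union, mem_sinkSourcePairs, mem_outPairs,
           Finset.mem_product, Finset.mem_singleton, Finset.mem_compl, Finset.mem_insert] at hx ⊢
         grind)
      | (rw [Finset.disjoint_left]
         rintro ⟨u, v⟩ hx hy
         simp only [Finset.mem_product,
           Finset.mem_singleton, Finset.mem_compl, Finset.mem_insert] at hx hy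
         grind)
      | (simp only [Finset.card_product, Finset.card_compl, Finset.card_singleton, hc3,
          Finset.card_pair hab, Fintype.card_fin]
         omega)
  have h13 : PrGnp N p (forbidEvent (sinkSourcePairs a b ∪ inPairs s a)) ≤
      (1 - p / 2) ^ (3 * N - 6) := by
    apply key _ ({a}ᶜ ×ˢ {a}) ({b} ×ˢ {a, b}ᶜ) ({s, a, b}ᶜ ×ˢ {s})
    all_goals first
      | (rintro ⟨u, v⟩ hx
         simp only [Finset.mem_union, mem_sinkSourcePairs, mem_inPairs,
           Finset.mem_product, Finset.mem_singleton, Finset.mem_compl, Finset.mem_insert] at hx ⊢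
         grind)
      | (rw [Finset.disjoint_left]
         rintro ⟨u, v⟩ hx hy
         simp only [Finset.mem_product,
           Finset.mem_singleton, Finset.mem_compl, Finset.mem_insert] at hx hy
         grind)
      | (simp only [Finset.card_product, Finset.card_compl, Finset.card_singleton, hc3,
          Finset.card_pair hab, Fintype.card_fin]
         omega)
  have h23 : PrGnp N p (forbidEvent (outPairs s b ∪ inPairs s a)) ≤
      (1 - p / 2) ^ (3 * N - 6) := by
    apply key _ ({b} ×ˢ {b}ᶜ) ({s} ×ˢ {s, b}ᶜ) ({s, a, b}ᶜ ×ˢ {a})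
    all_goals first
      | (rintro ⟨u, v⟩ hx
         simp only [Finset.mem_union, mem_outPairs, mem_inPairs,
           Finset.mem_product, Finset.mem_singleton, Finset.mem_compl, Finset.mem_insert] at hx ⊢
         grind)
      | (rw [Finset.disjoint_left]
         rintro ⟨u, v⟩ hx hy
         simp only [Finset.mem_product,
           Finset.mem_singleton, Finset.mem_compl, Finset.mem_insert] at hx hy
         grind)
      | (simp only [Finset.card_product, Finset.card_compl, Finset.card_singleton, hc3,
          Finset.card_pair hsb, Fintype.card_fin]
         omega)
  have hmono := PrGnp_mono hp (subset_joint hsa hsb hab)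
  have e1 := PrGnp_union_add_inter (p := p) (forbidEvent (sinkSourcePairs a b))
    (forbidEvent (outPairs s b))
  have e2 := PrGnp_union_add_inter (p := p)
    (forbidEvent (sinkSourcePairs a b) ∪ forbidEvent (outPairs s b)) (forbidEvent (inPairs s a))
  rw [Set.union_inter_distrib_right, forbidEvent_inter, forbidEvent_inter] at e2
  rw [forbidEvent_inter, PrGnp_sinkSource hp hab, PrGnp_outPairs hp hsb] at e1
  rw [PrGnp_inPairs hp hsa] at e2
  have e3 := PrGnp_union_le hp (forbidEvent (sinkSourcePairs a b ∪ inPairs s a))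
    (forbidEvent (outPairs s b ∪ inPairs s a))
  linarith

end JointEvent

lemma tendsto_PrGnp_not_reaches {p : ℝ} (hp : p ∈ Set.Ioc (0 : ℝ) 1)
    (s a : (n : ℕ) → Fin (n + 3)) (hsa : ∀ n, s n ≠ a n) :
    Tendsto (fun n : ℕ => PrGnp (n + 3) p {f | ¬ Reaches f (s n) (a n)} /
      (1 - p / 2) ^ (n + 2)) atTop (nhds 2) := by
  have hq0 : 0 < 1 - p / 2 := by linarith [hp.2]
  have hq1 : 1 - p / 2 < 1 := by linarith [hp.1]
  obtain ⟨θ, hθ0, hθ1, hqθ, -⟩ := exists_decay_rate hp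
  have hlow : Tendsto (fun n : ℕ => 2 - (1 - p / 2) ^ (n + 1)) atTop (nhds 2) := by
    have := (tendsto_pow_atTop_nhds_zero_of_lt_one hq0.le hq1).comp (tendsto_add_atTop_nat 1)
    simpa using this.const_sub 2
  have hupp : Tendsto (fun n : ℕ => 2 + 2 * (1 - p / 2) *
      (θ ^ (n + 3) * (1 + 2 * θ ^ (n + 3)) ^ (n + 3))) atTop (nhds 2) := by
    have := (tendsto_decay hθ0 hθ1 2 zero_le_two).comp (tendsto_add_atTop_nat 3)
    simpa using (this.const_mul (2 * (1 - p / 2))).const_add 2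
  refine tendsto_of_tendsto_of_tendsto_of_le_of_le' hlow hupp (Eventually.of_forall fun n => ?_) ?_
  · rw [le_div_iff₀ (by positivity)]
    have h := le_PrGnp_not_reaches hp (hsa n)
    rw [show 2 * (n + 3) - 3 = (n + 1) + (n + 2) by omega, show n + 3 - 1 = n + 2 by omega,
      pow_add _ (n + 1)] at h
    linarith
  · filter_upwards [eventually_ge_atTop 9] with n hn
    rw [div_le_iff₀ (by positivity)]
    refine (PrGnp_not_reaches_le hp hθ0 hθ1 hqθ (by omega) (s n) (a n)).trans (le_of_eq ?_)
    rw [show n + 3 - 1 = n + 2 by omega, pow_succ (1 - p / 2) (n + 2)]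
    ring

lemma tendsto_PrGnp_joint {p : ℝ} (hp : p ∈ Set.Ioc (0 : ℝ) 1)
    (s a b : (n : ℕ) → Fin (n + 3))
    (hsa : ∀ n, s n ≠ a n) (hsb : ∀ n, s n ≠ b n) (hab : ∀ n, a n ≠ b n) :
    Tendsto (fun n : ℕ =>
      PrGnp (n + 3) p {f | ¬ Reaches f (s n) (a n) ∧ ¬ Reaches f (b n) (s n)} /
        (1 - p / 2) ^ (2 * n + 3)) atTop (nhds 3) := by
  have hq0 : 0 < 1 - p / 2 := by linarith [hp.2]
  have hq1 : 1 - p / 2 < 1 := by linarith [hp.1]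
  obtain ⟨θ, hθ0, hθ1, hqθ, hrθ⟩ := exists_decay_rate hp
  have hlow : Tendsto (fun n : ℕ => 3 - 3 * (1 - p / 2) ^ n) atTop (nhds 3) := by
    simpa using ((tendsto_pow_atTop_nhds_zero_of_lt_one hq0.le hq1).const_mul 3).const_sub 3
  have hupp : Tendsto (fun n : ℕ => 3 + 4 * ((1 - p / 2) ^ 4 * θ ^ 6)⁻¹ * (1 - p / 2) ^ 3 *
      (θ ^ (n + 3) * (1 + 4 * θ ^ (n + 3)) ^ (n + 3))) atTop (nhds 3) := by
    have := (tendsto_decay hθ0 hθ1 4 zero_le_four).comp (tendsto_add_atTop_nat 3)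
    generalize ((1 - p / 2) ^ 4 * θ ^ 6)⁻¹ = C
    simpa using (this.const_mul (4 * C * (1 - p / 2) ^ 3)).const_add 3
  refine tendsto_of_tendsto_of_tendsto_of_le_of_le' hlow hupp (Eventually.of_forall fun n => ?_) ?_
  · rw [le_div_iff₀ (by positivity)]
    have h := le_PrGnp_joint hp (hsa n) (hsb n) (hab n)
    rw [show 2 * (n + 3) - 3 = 2 * n + 3 by omega,
      show 3 * (n + 3) - 6 = n + (2 * n + 3) by omega, pow_add _ n] at h
    linarith
  · filter_upwards [eventually_ge_atTop 9] with n hn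
    rw [div_le_iff₀ (by positivity)]
    refine (PrGnp_joint_le hp hθ0 hθ1 hqθ hrθ (by omega) (hsa n) (hsb n) (hab n)).trans
      (le_of_eq ?_)
    rw [show 2 * (n + 3) - 3 = 2 * n + 3 by omega,
      show 2 * (n + 3) = (2 * n + 3) + 3 by omega, pow_add _ (2 * n + 3) 3]
    generalize ((1 - p / 2) ^ 4 * θ ^ 6)⁻¹ = C
    ring

/-- Fix `p ∈ (0,1]` and distinct vertices `s, a, b` of `⃗G(n,p)`.
Then `Cov({s ↛ a}, {b ↛ s}) = (2p - 1 + o(1)) (1 - p/2)^(2n-3)`, i.e. the covariance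
divided by `(1 - p/2)^(2n-3)` tends to `2p - 1` (graphs on `n + 3` vertices). -/
theorem gnp_covariance_asymptotics
    (p : ℝ) (hp : p ∈ Set.Ioc (0 : ℝ) 1)
    (s a b : (n : ℕ) → Fin (n + 3))
    (hsa : ∀ n, s n ≠ a n) (hsb : ∀ n, s n ≠ b n) (hab : ∀ n, a n ≠ b n) :
    Filter.Tendsto (fun n : ℕ =>
        (PrGnp (n + 3) p {f | ¬ Reaches f (s n) (a n) ∧ ¬ Reaches f (b n) (s n)} -
            PrGnp (n + 3) p {f | ¬ Reaches f (s n) (a n)} *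
              PrGnp (n + 3) p {f | ¬ Reaches f (b n) (s n)}) /
          (1 - p / 2) ^ (2 * (n + 3) - 3))
      Filter.atTop (nhds (2 * p - 1)) := by
  have hq0 : 0 < 1 - p / 2 := by linarith [hp.2]
  have hlim := (tendsto_PrGnp_joint hp s a b hsa hsb hab).sub
    (((tendsto_PrGnp_not_reaches hp s a hsa).mul
      (tendsto_PrGnp_not_reaches hp b s fun n => (hsb n).symm)).const_mul (1 - p / 2))
  rw [show (3 : ℝ) - (1 - p / 2) * (2 * 2) = 2 * p - 1 by ring] at hlim
  refine hlim.congr fun n => ?_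
  rw [show 2 * (n + 3) - 3 = 2 * n + 3 by omega, sub_div]
  congr 1
  rw [show 2 * n + 3 = (n + 2) + n + 1 by omega]
  generalize 1 - p / 2 = q at hq0 ⊢
  field_simp
  ring
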